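/- (Krohn–Rhodes theorem) Let M be a finite monoid. Then there exist n ≥ 1 and finite monoids T₁, …, Tₙ, each of which is either a finite simple group that divides M, or isomorphic to the three-element flip-flop monoid U₂ = {1, a, b} with identity 1 and multiplication x·a = a and x·b = b for all x ∈ U₂, such that M divides the iterated wreath product Tₙ ≀ (Tₙ₋₁ ≀ (⋯ ≀ T₁)). -/

import Mathlib

/-- The wreath product `M ≀ N` of monoids: underlying set `(N → M) × N` with
multiplication `(f, n)·(f', n') = (x ↦ f x · f' (x·n), n·n')`. -/
def WreathProduct (M N : Type) [Monoid M] [Monoid N] : Type := (N → M) × N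

instance WreathProduct.instMonoid (M N : Type) [Monoid M] [Monoid N] :
    Monoid (WreathProduct M N) where
  mul p q := (fun x => p.1 x * q.1 (x * p.2), p.2 * q.2)
  one := (fun _ => 1, 1)
  mul_assoc p q r := by
    refine Prod.ext ?_ (mul_assoc _ _ _)
    funext x
    show (p.1 x * q.1 (x * p.2)) * r.1 (x * (p.2 * q.2))
        = p.1 x * (q.1 (x * p.2) * r.1 ((x * p.2) * q.2))
    rw [← mul_assoc x p.2 q.2, mul_assoc]
  one_mul p := by
    refine Prod.ext ?_ (one_mul _)
    funext x
    show (1 : M) * p.1 (x * 1) = p.1 x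
    rw [one_mul, mul_one]
  mul_one p := by
    refine Prod.ext ?_ (mul_one _)
    funext x
    show p.1 x * 1 = p.1 x
    rw [mul_one]

/-- A bundled monoid. -/
structure BMon where
  carrier : Type
  [mon : Monoid carrier]

attribute [instance] BMon.mon

/-- The iterated wreath product `Tₙ ≀ (Tₙ₋₁ ≀ (⋯ ≀ T₁))` of the nonempty list
`Tₙ, [Tₙ₋₁, …, T₁]` of monoids. -/
def iterWreath : BMon → List BMon → BMon
  | T, [] => T
  | T, R :: rest => ⟨WreathProduct T.carrier (iterWreath R rest).carrier⟩

/-- A monoid `S` divides a monoid `T` if `S` is a homomorphic image of a submonoid of `T`. -/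
def MonoidDivides (S T : Type) [Monoid S] [Monoid T] : Prop :=
  ∃ (U : Submonoid T) (φ : U →* S), Function.Surjective φ

/-- The three-element flip-flop monoid `U₂ = {1, a, b}` with `x·a = a`, `x·b = b`. -/
inductive U2 : Type
  | one : U2
  | a : U2
  | b : U2

instance : Monoid U2 where
  mul x y := match y with
    | U2.one => x
    | U2.a => U2.a
    | U2.b => U2.b
  one := U2.one
  mul_assoc x y z := by cases z <;> cases y <;> rfl
  one_mul x := by cases x <;> rfl
  mul_one _ := rfl

/-! ### Division -/

namespace MonoidDivides

/-- Division can be witnessed on generators: it suffices to lift a generating set of `S` to `T`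
and to exhibit an invariant relation by which elements of `T` determine elements of `S`. -/
theorem of_closure {S T : Type} [Monoid S] [Monoid T] (A : Set S) (hA : Submonoid.closure A = ⊤)
    (lift : S → T) (Inv : S → T → Prop) (one : Inv 1 1)
    (step : ∀ s t, Inv s t → ∀ a ∈ A, Inv (s * a) (t * lift a))
    (det : ∀ s s' t, Inv s t → Inv s' t → s = s') : MonoidDivides S T := by
  set R : Submonoid (S × T) := Submonoid.closure ((fun a => (a, lift a)) '' A) with hR
  have hinv : ∀ p ∈ R, Inv p.1 p.2 := by
    intro p hp
    induction hp using Submonoid.closure_induction_right with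
    | one => exact one
    | mul_right x _ y hy ih =>
      obtain ⟨a, ha, rfl⟩ := hy
      exact step _ _ ih a ha
  have htotal : ∀ s, ∃ t, (s, t) ∈ R := by
    intro s
    have hmap : R.map (MonoidHom.fst S T) = ⊤ := by
      rw [hR, MonoidHom.map_mclosure, Set.image_image]
      simpa using hA
    have hs : s ∈ R.map (MonoidHom.fst S T) := hmap ▸ Submonoid.mem_top s
    obtain ⟨⟨_, t⟩, ht, rfl⟩ := hs
    exact ⟨t, ht⟩
  have hdet : ∀ {s s' t}, (s, t) ∈ R → (s', t) ∈ R → s = s' := fun h h' =>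
    det _ _ _ (hinv _ h) (hinv _ h')
  choose f hf using fun t : R.map (MonoidHom.snd S T) =>
    (show ∃ s, (s, (t : T)) ∈ R by
      obtain ⟨t, ⟨s, t'⟩, h, rfl⟩ := t
      exact ⟨s, h⟩)
  refine ⟨R.map (MonoidHom.snd S T), ⟨⟨f, ?_⟩, ?_⟩, ?_⟩
  · exact hdet (hf 1) R.one_mem
  · intro x y
    exact hdet (hf (x * y)) (R.mul_mem (hf x) (hf y))
  · intro s
    obtain ⟨t, ht⟩ := htotal s
    exact ⟨⟨t, (s, t), ht, rfl⟩, hdet (hf _) ht⟩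

theorem of_surjective {S T : Type} [Monoid S] [Monoid T] (f : T →* S)
    (hf : Function.Surjective f) : MonoidDivides S T :=
  ⟨⊤, f.comp (⊤ : Submonoid T).subtype, fun s => by
    obtain ⟨t, rfl⟩ := hf s
    exact ⟨⟨t, trivial⟩, rfl⟩⟩

theorem of_injective {S T : Type} [Monoid S] [Monoid T] (f : S →* T)
    (hf : Function.Injective f) : MonoidDivides S T :=
  of_closure Set.univ Submonoid.closure_univ f (fun s t => f s = t) (map_one f)
    (fun s t h a _ => by rw [map_mul, h]) (fun _ _ _ h h' => hf (h.trans h'.symm))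

theorem refl (S : Type) [Monoid S] : MonoidDivides S S :=
  of_injective (MonoidHom.id S) Function.injective_id

theorem trans {S T V : Type} [Monoid S] [Monoid T] [Monoid V] (h : MonoidDivides S T)
    (h' : MonoidDivides T V) : MonoidDivides S V := by
  obtain ⟨U, φ, hφ⟩ := h
  obtain ⟨W, ψ, hψ⟩ := h'
  choose p hp using hφ
  choose q hq using hψ
  refine of_closure Set.univ Submonoid.closure_univ (fun s => (q (p s : T) : V))
    (fun s v => ∃ (w : W) (u : U), (w : V) = v ∧ ψ w = u ∧ φ u = s)
    ⟨1, 1, rfl, by simp, map_one φ⟩ ?_ ?_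
  · rintro s v ⟨w, u, rfl, hwu, rfl⟩ a -
    exact ⟨w * q (p a), u * p a, rfl, by simp [hwu, hq], by simp [hp]⟩
  · rintro s s' v ⟨w, u, rfl, hwu, rfl⟩ ⟨w', u', hw, hwu', rfl⟩
    obtain rfl : w' = w := Subtype.ext hw
    rw [Subtype.ext (hwu.symm.trans hwu')]

/-- A criterion for dividing a wreath product in terms of the state reached from `(1, 1)`. -/
theorem wreath_of_closure {S A B : Type} [Monoid S] [Monoid A] [Monoid B] (gen : Set S)
    (hgen : Submonoid.closure gen = ⊤) (liftA : S → B → A) (liftB : S → B)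
    (Inv : S → A → B → Prop) (one : Inv 1 1 1)
    (step : ∀ s a b, Inv s a b → ∀ g ∈ gen, Inv (s * g) (a * liftA g b) (b * liftB g))
    (det : ∀ s s' a b, Inv s a b → Inv s' a b → s = s') :
    MonoidDivides S (WreathProduct A B) := by
  refine of_closure gen hgen (fun s => ((liftA s, liftB s) : (B → A) × B))
    (fun s w => Inv s (w.1 1) w.2) one ?_ (fun s s' w => det s s' _ _)
  intro s w h g hg
  have := step _ _ _ h g hg
  rw [← one_mul w.2] at this
  change Inv (s * g) (w.1 1 * liftA g (1 * w.2)) (w.2 * liftB g)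
  rwa [one_mul] at this ⊢

theorem wreath_mono {S A T B : Type} [Monoid S] [Monoid A] [Monoid T] [Monoid B]
    (h : MonoidDivides S A) (h' : MonoidDivides T B) :
    MonoidDivides (WreathProduct S T) (WreathProduct A B) := by
  classical
  obtain ⟨U, φ, hφ⟩ := h
  obtain ⟨V, ψ, hψ⟩ := h'
  choose p hp using hφ
  choose q hq using hψ
  refine of_closure Set.univ Submonoid.closure_univ
    (fun w => ((fun b => if hb : b ∈ V then (p (w.1 (ψ ⟨b, hb⟩)) : A) else 1, (q w.2 : B)) :
      (B → A) × B))
    (fun s w => ∃ (f : V → U) (v : V), (∀ x : V, (f x : A) = w.1 x) ∧ (v : B) = w.2 ∧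
      (∀ x, φ (f x) = s.1 (ψ x)) ∧ ψ v = s.2)
    ⟨fun _ => 1, 1, fun _ => rfl, rfl, fun _ => map_one φ, map_one ψ⟩ ?_ ?_
  · rintro s w ⟨f, v, hf, hv, hfs, hvs⟩ a -
    refine ⟨fun x => f x * p (a.1 (ψ (x * v))), v * q a.2, fun x => ?_, ?_, fun x => ?_, ?_⟩
    · change (f x : A) * p (a.1 (ψ (x * v))) = w.1 x * dite ((x : B) * w.2 ∈ V) _ _
      rw [← hf, ← hv, dif_pos (V.mul_mem x.2 v.2)]
      rfl
    · change (v : B) * q a.2 = w.2 * q a.2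
      rw [hv]
    · change _ = s.1 (ψ x) * a.1 (ψ x * s.2)
      rw [map_mul, hp, hfs, map_mul, hvs]
    · change _ = s.2 * a.2
      rw [map_mul, hq, hvs]
  · rintro s s' w ⟨f, v, hf, hv, hfs, hvs⟩ ⟨f', v', hf', hv', hfs', hvs'⟩
    obtain rfl : f = f' := funext fun x => Subtype.ext ((hf x).trans (hf' x).symm)
    obtain rfl : v = v' := Subtype.ext (hv.trans hv'.symm)
    refine Prod.ext (funext fun t => ?_) (hvs.symm.trans hvs')
    rw [← hq t, ← hfs, ← hfs']

theorem wreath_assoc (A B C : Type) [Monoid A] [Monoid B] [Monoid C] :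
    MonoidDivides (WreathProduct (WreathProduct A B) C)
      (WreathProduct A (WreathProduct B C)) := by
  refine of_injective
    { toFun := fun w => ((fun y => (w.1 y.2).1 (y.1 1), (fun x => (w.1 x).2, w.2)) :
        (WreathProduct B C → A) × WreathProduct B C)
      map_one' := rfl
      map_mul' := fun w w' => ?_ } ?_
  · refine Prod.ext (funext fun y => ?_) rfl
    change (w.1 y.2).1 (y.1 1) * (w'.1 (y.2 * w.2)).1 (y.1 1 * (w.1 y.2).2) =
      (w.1 y.2).1 (y.1 1) * (w'.1 (y.2 * w.2)).1 (y.1 1 * (w.1 (1 * y.2)).2)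
    rw [one_mul]
  · intro w w' h
    have h1 := congrFun (congrArg Prod.fst h)
    have h2 : ((fun x => (w.1 x).2, w.2) : (C → B) × C) = (fun x => (w'.1 x).2, w'.2) :=
      congrArg Prod.snd h
    refine Prod.ext (funext fun x => Prod.ext (funext fun b => ?_) ?_) (congrArg Prod.snd h2 :)
    · exact h1 ((fun _ => b, x) : (C → B) × C)
    · exact congrFun (congrArg Prod.fst h2) x

theorem prod_wreath (A B : Type) [Monoid A] [Monoid B] :
    MonoidDivides (A × B) (WreathProduct A B) :=
  of_injective
    { toFun := fun p => ((fun _ => p.1, p.2) : (B → A) × B)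
      map_one' := rfl
      map_mul' := fun _ _ => rfl }
    fun _ _ h => Prod.ext (congrFun (congrArg Prod.fst h) 1)
      (congrArg Prod.snd h :)

/-- Every group extension embeds into the wreath product of kernel and quotient. -/
theorem group_wreath (G : Type) [Group G] (H : Subgroup G) [H.Normal] :
    MonoidDivides G (WreathProduct H (G ⧸ H)) := by
  choose r hr using QuotientGroup.mk_surjective (s := H)
  have hmem : ∀ (x : G ⧸ H) (g : G), r x * g * (r (x * g))⁻¹ ∈ H := fun x g => by
    rw [← QuotientGroup.eq_one_iff]
    simp [hr]
  refine of_injective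
    { toFun := fun g => ((fun x => ⟨r x * g * (r (x * g))⁻¹, hmem x g⟩, (g : G ⧸ H)) :
        (G ⧸ H → H) × (G ⧸ H))
      map_one' := Prod.ext (funext fun x => Subtype.ext ?_) rfl
      map_mul' := fun g g' => Prod.ext (funext fun x => Subtype.ext ?_) rfl } ?_
  · change r x * 1 * (r (x * ((1 : G) : G ⧸ H)))⁻¹ = 1
    simp
  · change r x * (g * g') * (r (x * ((g * g' : G) : G ⧸ H)))⁻¹ =
      r x * g * (r (x * g))⁻¹ * (r (x * g) * g' * (r (x * g * g'))⁻¹)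
    rw [QuotientGroup.mk_mul, ← mul_assoc x]
    group
  · intro g g' h
    have h1 := congrArg Subtype.val (congrFun (congrArg Prod.fst h) 1)
    have h2 : (g : G ⧸ H) = g' := congrArg Prod.snd h
    change r 1 * g * (r (1 * g))⁻¹ = r 1 * g' * (r (1 * g'))⁻¹ at h1
    rw [h2] at h1
    exact mul_left_cancel (mul_right_cancel h1)

end MonoidDivides

/-! ### Reset monoids, constants and local divisors -/

/-- The monoid of an identity together with right zeros indexed by `X`. -/
inductive ResetMonoid (X : Type) : Type
  | one : ResetMonoid X
  | reset : X → ResetMonoid X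

namespace ResetMonoid

instance (X : Type) : Monoid (ResetMonoid X) where
  mul x y := match y with
    | one => x
    | reset z => reset z
  one := one
  mul_assoc x y z := by cases z <;> cases y <;> rfl
  one_mul x := by cases x <;> rfl
  mul_one _ := rfl

theorem mul_reset {X : Type} (u : ResetMonoid X) (x : X) : u * reset x = reset x := rfl

open Classical in
theorem divides_pi (X : Type) : MonoidDivides (ResetMonoid X) (X → U2) := by
  refine MonoidDivides.of_injective
    { toFun := fun u => match u with
        | one => 1
        | reset x => fun y => if y = x then U2.a else U2.b
      map_one' := rfl
      map_mul' := fun u v => ?_ } ?_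
  · cases v with
    | one => rfl
    | reset x =>
      funext y
      change ite (y = x) U2.a U2.b = _ * ite (y = x) U2.a U2.b
      split_ifs <;> rfl
  · rintro (_ | x) (_ | y) h
    · rfl
    · have := congrFun h y
      change U2.one = ite (y = y) U2.a U2.b at this
      simp at this
    · have := congrFun h x
      change ite (x = x) U2.a U2.b = U2.one at this
      simp at this
    · have := congrFun h x
      change ite (x = x) U2.a U2.b = ite (x = y) U2.a U2.b at this
      by_cases hxy : x = y
      · rw [hxy]
      · simp [hxy] at this

end ResetMonoid

/-- The monoid `S` acting on itself by right translations, augmented by the constant maps. -/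
inductive WithConst (S : Type) : Type
  | act : S → WithConst S
  | const : S → WithConst S

namespace WithConst

/-- The image of `1 : S` under an element acting on `S`. -/
def val {S : Type} : WithConst S → S
  | act s => s
  | const s => s

instance (S : Type) [Monoid S] : Monoid (WithConst S) where
  mul x y := match x, y with
    | act s, act t => act (s * t)
    | const s, act t => const (s * t)
    | _, const t => const t
  one := act 1
  mul_assoc x y z := by
    cases x <;> cases y <;> cases z <;>
      first | rfl | exact congrArg act (mul_assoc _ _ _) | exact congrArg const (mul_assoc _ _ _)
  one_mul x := by cases x <;> first | rfl | exact congrArg act (one_mul _)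
  mul_one x := by
    cases x <;>
      first | exact congrArg act (mul_one _) | exact congrArg const (mul_one _)

variable {S : Type} [Monoid S]

theorem mul_const (x : WithConst S) (s : S) : x * const s = const s := by cases x <;> rfl

theorem const_mul_act (s t : S) : const s * act t = const (s * t) := rfl

theorem val_mul_act (x : WithConst S) (s : S) : (x * act s).val = x.val * s := by
  cases x <;> rfl

theorem divides (S : Type) [Monoid S] : MonoidDivides S (WithConst S) :=
  .of_injective ⟨⟨act, rfl⟩, fun _ _ => rfl⟩ fun _ _ h => by injection h

theorem group_divides (G : Type) [Group G] :
    MonoidDivides (WithConst G) (WreathProduct (ResetMonoid G) G) := by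
  refine MonoidDivides.wreath_of_closure Set.univ Submonoid.closure_univ
    (fun s b => match s with
      | act _ => 1
      | const k => .reset (k * b⁻¹))
    (fun s => match s with
      | act g => g
      | const _ => 1)
    (fun s u g => match u with
      | .one => s = act g
      | .reset h => s = const (h * g)) rfl ?_ ?_
  · rintro s (_ | h) g hs (a | k) -
    · subst hs; rfl
    · simp [mul_const]
    · subst hs
      exact congrArg const (mul_assoc _ _ _)
    · simp [mul_const]
  · rintro s s' (_ | h) g hs hs' <;> exact hs.trans hs'.symm

end WithConst

/-- The local divisor of `S` at `c`: the set `cS ∩ Sc` with `vc ∘ cu = vcu`. -/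
def LocalDivisor {S : Type} [Monoid S] (c : S) : Type :=
  {x : S // (∃ u, x = c * u) ∧ ∃ v, x = v * c}

namespace LocalDivisor

variable {S : Type} [Monoid S] {c : S}

instance [Finite S] : Finite (LocalDivisor c) := Subtype.finite

/-- A right cofactor of an element of the local divisor. -/
noncomputable def cofactor (x : LocalDivisor c) : S := x.2.1.choose

theorem mul_cofactor (x : LocalDivisor c) : c * x.cofactor = x.1 := x.2.1.choose_spec.symm

theorem mul_cofactor_mul (v : S) (x : LocalDivisor c) : v * c * x.cofactor = v * x.1 := by
  rw [mul_assoc, mul_cofactor]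

noncomputable instance : Mul (LocalDivisor c) where
  mul x y := ⟨x.1 * y.cofactor, ⟨x.cofactor * y.cofactor, by
      rw [← mul_assoc, mul_cofactor]⟩, by
      obtain ⟨v, hv⟩ := x.2.2
      obtain ⟨w, hw⟩ := y.2.2
      exact ⟨v * w, by rw [hv, mul_cofactor_mul, hw, mul_assoc]⟩⟩

theorem coe_mul (x y : LocalDivisor c) : (x * y).1 = x.1 * y.cofactor := rfl

theorem coe_mul_of_eq {x y : LocalDivisor c} {u : S} (h : y.1 = c * u) :
    (x * y).1 = x.1 * u := by
  obtain ⟨v, hv⟩ := x.2.2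
  rw [coe_mul, hv, mul_cofactor_mul, h, mul_assoc]

noncomputable instance : Monoid (LocalDivisor c) where
  one := ⟨c, ⟨1, (mul_one c).symm⟩, ⟨1, (one_mul c).symm⟩⟩
  one_mul x := Subtype.ext (mul_cofactor x)
  mul_one x := Subtype.ext ((coe_mul_of_eq (mul_one c).symm).trans (mul_one _))
  mul_assoc x y z := Subtype.ext <| by
    rw [coe_mul_of_eq (x := x) (y := y * z) (u := y.cofactor * z.cofactor), coe_mul, coe_mul,
      mul_assoc]
    rw [coe_mul, ← mul_cofactor y, mul_assoc]

theorem divides (c : S) : MonoidDivides (LocalDivisor c) S :=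
  .of_closure Set.univ Submonoid.closure_univ cofactor (fun x s => c * s = x.1) (mul_one c)
    (fun x s h y _ => by rw [← mul_assoc, h, coe_mul])
    fun _ _ _ h h' => Subtype.ext (h.symm.trans h')

theorem card_lt [Finite S] (hc : ¬ IsUnit c) : Nat.card (LocalDivisor c) < Nat.card S := by
  refine Finite.card_subtype_lt (x := 1) ?_
  rintro ⟨⟨u, hu⟩, v, hv⟩
  exact hc ⟨⟨c, u, hu.symm, by rw [← left_inv_eq_right_inv hv.symm hu.symm, ← hv]⟩, rfl⟩

/-- The element `cxc`. -/
def sandwich (c x : S) : LocalDivisor c :=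
  ⟨c * x * c, ⟨x * c, mul_assoc _ _ _⟩, ⟨c * x, rfl⟩⟩

theorem coe_mul_sandwich (p : LocalDivisor c) (x : S) :
    (p * sandwich c x).1 = p.1 * x * c := by
  rw [coe_mul_of_eq (u := x * c) (mul_assoc c x c), mul_assoc]

end LocalDivisor

namespace WithConst

/-- Local divisor decomposition: a word over `N ∪ {c}` is processed by remembering in the bottom
component the last factor from `N`, and in the top component the part from the first to the last
occurrence of `c` together with the prefix in front of it. A reset is recorded in the bottom
component until the next `c`; the Boolean tells whether a reset has ever occurred. -/
theorem divides_localDivisor {S : Type} [Monoid S] (N : Submonoid S) (c : S)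
    (h : Submonoid.closure (insert c (N : Set S)) = ⊤) :
    MonoidDivides (WithConst S)
      (WreathProduct (WithConst (LocalDivisor c) × ResetMonoid (S × Bool))
        (WithConst N × ResetMonoid (Option S))) := by
  classical
  let mk : Bool → S → WithConst S := fun b => if b then const else act
  have hmk : ∀ b s t, mk b s * act t = mk b (s * t) := by rintro (_ | _) s t <;> rfl
  let gen : Set (WithConst S) := act '' insert c (N : Set S) ∪ Set.range const
  have hgen : Submonoid.closure gen = ⊤ := by
    rw [eq_top_iff]
    rintro (s | s) -
    · let i : S →* WithConst S := ⟨⟨act, rfl⟩, fun _ _ => rfl⟩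
      have hs : act s ∈ (Submonoid.closure (insert c (N : Set S))).map i :=
        ⟨s, h ▸ Submonoid.mem_top s, rfl⟩
      rw [MonoidHom.map_mclosure] at hs
      exact Submonoid.closure_mono Set.subset_union_left hs
    · exact Submonoid.subset_closure (Or.inr ⟨s, rfl⟩)
  refine MonoidDivides.wreath_of_closure gen hgen
    (fun s b => match s with
      | act g =>
        if g ∈ N then 1
        else match b.2 with
          | .one => (const 1, .reset (b.1.val, false))
          | .reset (some t) => (const 1, .reset (t * b.1.val, true))
          | .reset none => (act (.sandwich c b.1.val), 1)
      | const _ => 1)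
    (fun s => match s with
      | act g => if hg : g ∈ N then (act ⟨g, hg⟩, 1) else (const 1, .reset none)
      | const t => (const 1, .reset (some t)))
    (fun s a b => match b.2 with
      | .one => ∃ n : N, b.1 = act n ∧ s = act n.1
      | .reset (some t) => s = const (t * b.1.val)
      | .reset none => ∃ y d, a.2 = .reset (y, d) ∧ s = mk d (y * a.1.val.1 * b.1.val))
    ⟨1, rfl, rfl⟩ ?_ ?_
  · rintro s ⟨p, u⟩ ⟨x, q⟩ hs _ (⟨g, hg, rfl⟩ | ⟨t, rfl⟩)
    · by_cases hgN : g ∈ N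
      · simp only [hgN, dif_pos, if_pos, mul_one, Prod.mk_mul_mk]
        rcases q with _ | _ | t
        · obtain ⟨n, rfl, rfl⟩ := hs
          exact ⟨n * ⟨g, hgN⟩, rfl, rfl⟩
        · obtain ⟨y, d, hu, rfl⟩ := hs
          refine ⟨y, d, hu, ?_⟩
          rw [hmk, val_mul_act, Submonoid.coe_mul, ← mul_assoc]
        · change s = _ at hs
          subst hs
          change _ = const _
          rw [const_mul_act, val_mul_act, Submonoid.coe_mul, ← mul_assoc]
      · obtain rfl : g = c := hg.resolve_right hgN
        simp only [hgN, dif_neg, if_neg, not_false_eq_true, Prod.mk_mul_mk,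
          ResetMonoid.mul_reset, mul_const]
        have hp : (p * const 1).val.1 = g := by
          rw [mul_const]
          rfl
        rcases q with _ | _ | t
        · obtain ⟨n, rfl, rfl⟩ := hs
          refine ⟨n, false, rfl, ?_⟩
          change act (n.1 * g) = act (n.1 * (p * const 1).val.1 * 1)
          rw [hp, mul_one]
        · obtain ⟨y, d, hu, rfl⟩ := hs
          refine ⟨y, d, hu, ?_⟩
          change mk d _ * act g = mk d (y * (p * act (LocalDivisor.sandwich g x.val.1)).val.1 * 1)
          rw [hmk, val_mul_act, LocalDivisor.coe_mul_sandwich, mul_one]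
          simp only [mul_assoc]
        · change s = _ at hs
          subst hs
          refine ⟨_, true, rfl, ?_⟩
          change const (t * x.val * g) = const (t * x.val * (p * const 1).val.1 * 1)
          rw [hp, mul_one]
    · simp only [mul_const, Prod.mk_mul_mk, ResetMonoid.mul_reset]
      simp [val]
  · rintro s s' ⟨p, u⟩ ⟨x, _ | _ | t⟩ hs hs'
    · obtain ⟨n, hn, rfl⟩ := hs
      obtain ⟨n', hn', rfl⟩ := hs'
      rw [hn] at hn'
      injection hn' with hn'
      rw [hn']
    · obtain ⟨y, d, hu, rfl⟩ := hs
      obtain ⟨y', d', hu', rfl⟩ := hs'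
      rw [hu] at hu'
      injection hu' with hu'
      injection hu' with hy hd
      rw [hy, hd]
    · exact hs.trans hs'.symm

end WithConst

/-! ### Monoids with a Krohn–Rhodes decomposition -/

/-- `T` is a finite simple group dividing `M`, or the flip-flop monoid. -/
def IsKRFactor (M : Type) [Monoid M] (T : BMon) : Prop :=
  (∃ (instG : Group T.carrier), Finite T.carrier ∧
    (∀ x y : T.carrier, instG.mul x y = x * y) ∧
    @IsSimpleGroup T.carrier instG ∧ MonoidDivides T.carrier M) ∨
  Nonempty (T.carrier ≃* U2)

/-- `S` divides an iterated wreath product of copies of `U2` and simple groups dividing `M`. -/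
def KRDecomposable (M S : Type) [Monoid M] [Monoid S] : Prop :=
  ∃ (T : BMon) (l : List BMon), (∀ Ti ∈ T :: l, IsKRFactor M Ti) ∧
    MonoidDivides S (iterWreath T l).carrier

theorem wreath_iterWreath_divides (T R : BMon) (l l' : List BMon) :
    MonoidDivides (WreathProduct (iterWreath T l).carrier (iterWreath R l').carrier)
      (iterWreath T (l ++ R :: l')).carrier := by
  induction l generalizing T with
  | nil => exact .refl _
  | cons T' l ih =>
    exact (MonoidDivides.wreath_assoc _ _ _).trans (.wreath_mono (.refl _) (ih T'))

namespace KRDecomposable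

variable {M : Type} [Monoid M]

theorem of_divides {S T : Type} [Monoid S] [Monoid T] (hT : KRDecomposable M T)
    (h : MonoidDivides S T) : KRDecomposable M S := by
  obtain ⟨R, l, hl, hR⟩ := hT
  exact ⟨R, l, hl, h.trans hR⟩

theorem wreath {S T : Type} [Monoid S] [Monoid T] (hS : KRDecomposable M S)
    (hT : KRDecomposable M T) : KRDecomposable M (WreathProduct S T) := by
  obtain ⟨R, l, hl, hR⟩ := hS
  obtain ⟨R', l', hl', hR'⟩ := hT
  refine ⟨R, l ++ R' :: l', fun Ti h => ?_,
    (MonoidDivides.wreath_mono hR hR').trans (wreath_iterWreath_divides _ _ _ _)⟩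
  rw [← List.cons_append, List.mem_append] at h
  exact h.elim (hl Ti) (hl' Ti)

theorem prod {S T : Type} [Monoid S] [Monoid T] (hS : KRDecomposable M S)
    (hT : KRDecomposable M T) : KRDecomposable M (S × T) :=
  (hS.wreath hT).of_divides (.prod_wreath S T)

theorem of_factor {S : Type} [Monoid S] (h : IsKRFactor M ⟨S⟩) : KRDecomposable M S :=
  ⟨⟨S⟩, [], by simpa using h, .refl _⟩

theorem flipFlop : KRDecomposable M U2 := of_factor (.inr ⟨MulEquiv.refl U2⟩)

theorem of_subsingleton (S : Type) [Monoid S] [Subsingleton S] : KRDecomposable M S :=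
  flipFlop.of_divides (.of_injective 1 (Function.injective_of_subsingleton _))

theorem pi_fin {S : Type} [Monoid S] (hS : KRDecomposable M S) (n : ℕ) :
    KRDecomposable M (Fin n → S) := by
  induction n with
  | zero => exact of_subsingleton _
  | succ n ih =>
    refine (hS.prod ih).of_divides (.of_injective
      ⟨⟨fun f => (f 0, fun i => f i.succ), rfl⟩, fun _ _ => rfl⟩ fun f g h => funext fun i => ?_)
    refine Fin.cases (congrArg Prod.fst h :) (fun j => ?_) i
    exact congrFun (congrArg Prod.snd h) j

theorem resetMonoid (X : Type) [Finite X] : KRDecomposable M (ResetMonoid X) := by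
  obtain ⟨n, ⟨e⟩⟩ := Finite.exists_equiv_fin X
  refine (flipFlop.pi_fin n).of_divides ((ResetMonoid.divides_pi X).trans (.of_injective
    ⟨⟨fun f i => f (e.symm i), rfl⟩, fun _ _ => rfl⟩ fun f g h => funext fun x => ?_))
  simpa using congrFun h (e x)

theorem group (G : Type) [Group G] [Finite G] (hG : MonoidDivides G M) : KRDecomposable M G := by
  induction hn : Nat.card G using Nat.strong_induction_on generalizing G with
  | _ n ih =>
  subst hn
  cases subsingleton_or_nontrivial G with
  | inl _ => exact of_subsingleton G
  | inr _ =>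
    by_cases hs : IsSimpleGroup G
    · exact of_factor (.inl ⟨inferInstance, ‹_›, fun _ _ => rfl, hs, hG⟩)
    · obtain ⟨H, hH, hbot, htop⟩ : ∃ H : Subgroup G, H.Normal ∧ H ≠ ⊥ ∧ H ≠ ⊤ := by
        by_contra! hcon
        exact hs ⟨fun H hH => or_iff_not_imp_left.2 (hcon H hH)⟩
      have hcard := H.card_eq_card_quotient_mul_card_subgroup
      have hH1 : 1 < Nat.card H := (Subgroup.one_lt_card_iff_ne_bot H).2 hbot
      have hQ1 : 1 < Nat.card (G ⧸ H) := Subgroup.one_lt_index_of_ne_top htop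
      refine KRDecomposable.of_divides (.wreath (ih _ ?_ H ?_ rfl) (ih _ ?_ (G ⧸ H) ?_ rfl))
        (.group_wreath G H)
      · nlinarith
      · exact .trans (.of_injective H.subtype H.subtype_injective) hG
      · nlinarith
      · exact .trans (.of_surjective (QuotientGroup.mk' H) (QuotientGroup.mk'_surjective H)) hG

theorem withConst (S : Type) [Monoid S] [Finite S] (hS : MonoidDivides S M) :
    KRDecomposable M (WithConst S) := by
  induction hn : Nat.card S using Nat.strong_induction_on generalizing S with
  | _ n ih =>
  subst hn
  by_cases hu : ∀ x : S, IsUnit x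
  · let := groupOfIsUnit hu
    exact ((resetMonoid S).wreath (group S hS)).of_divides (WithConst.group_divides S)
  · have hne : IsUnit.submonoid S ≠ ⊤ := fun h => hu fun x => (h ▸ Submonoid.mem_top x :)
    obtain ⟨N, hN, hmax⟩ := Set.Finite.exists_le_maximal
      (Set.toFinite {N : Submonoid S | N ≠ ⊤}) hne
    obtain ⟨c, hc⟩ : ∃ c, c ∉ N := by
      by_contra! hcon
      exact hmax.prop (eq_top_iff.2 fun x _ => hcon x)
    have hgen : Submonoid.closure (insert c (N : Set S)) = ⊤ := by
      by_contra hcon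
      refine hc (hmax.le_of_ge hcon (fun x hx => Submonoid.subset_closure (Or.inr hx))
        (Submonoid.subset_closure (Or.inl rfl)))
    refine KRDecomposable.of_divides (.wreath
      (.prod (ih _ (LocalDivisor.card_lt fun h => hc (hN h)) (LocalDivisor c) ?_ rfl)
        (resetMonoid _))
      (.prod (ih _ (Finite.card_subtype_lt hc) N ?_ rfl) (resetMonoid _)))
      (WithConst.divides_localDivisor N c hgen)
    · exact (LocalDivisor.divides c).trans hS
    · exact .trans (.of_injective N.subtype Subtype.val_injective) hS

end KRDecomposable

/-- Krohn–Rhodes theorem: every finite monoid `M` divides an iterated wreath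
product `Tₙ ≀ (Tₙ₋₁ ≀ (⋯ ≀ T₁))` (`n ≥ 1`) in which each `Tᵢ` is either a finite simple group
dividing `M` or a copy of the flip-flop monoid `U₂`. -/
theorem krohn_rhodes (M : Type) [Monoid M] [Finite M] :
    ∃ (T : BMon) (l : List BMon),
      (∀ Ti ∈ T :: l,
        (∃ (instG : Group Ti.carrier), Finite Ti.carrier ∧
          (∀ x y : Ti.carrier, instG.mul x y = x * y) ∧
          @IsSimpleGroup Ti.carrier instG ∧ MonoidDivides Ti.carrier M) ∨
        Nonempty (Ti.carrier ≃* U2)) ∧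
      MonoidDivides M (iterWreath T l).carrier := by
  exact (KRDecomposable.withConst M (.refl M)).of_divides (WithConst.divides M)
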